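/- arXiv:1401.2772 — 2 statements merged into one kernel-verified Lean document; each statement's English description precedes it below -/
import Mathlib

section
/- Let n ≥ 1, 1 < p < ∞ and set κ = (n+2)/n. There exists a constant c = c(n,p) > 0 such that for every bounded open set U ⊂ ℝⁿ, all 0 < ε < T < ∞, and every measurable function u on U × (ε,T) such that u(·,t) is smooth with compact support in U for almost every t ∈ (ε,T), one has ∫_ε^T ∫_U |u|^{κp} dx dt ≤ c ( ∫_ε^T ∫_U |∇u|^p dx dt ) ( ess sup_{ε<t<T} ∫_U u(x,t)² dx )^{p/n}. -/
open MeasureTheory Real Set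
open scoped ENNReal NNReal

/-- A compactly supported `C¹` function on the one-dimensional Euclidean space is bounded by the
`L¹` norm of its derivative. -/
theorem enorm_le_lintegral_enorm_fderiv_of_fin_one {v : EuclideanSpace ℝ (Fin 1) → ℝ}
    (hv : ContDiff ℝ 1 v) (hcv : HasCompactSupport v) (x : EuclideanSpace ℝ (Fin 1)) :
    ‖v x‖ₑ ≤ ∫⁻ y, ‖fderiv ℝ v y‖ₑ := by
  let e : ℝ ≃ₗᵢ[ℝ] EuclideanSpace ℝ (Fin 1) := (OrthonormalBasis.singleton (Fin 1) ℝ).repr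
  have hcomp : ContDiff ℝ 1 (v ∘ e) := hv.comp e.contDiff
  have hccomp : HasCompactSupport (v ∘ e) := hcv.comp_homeomorph e.toHomeomorph
  have hderiv (t : ℝ) : ‖deriv (v ∘ e) t‖ₑ ≤ ‖fderiv ℝ v (e t)‖ₑ := by
    have h : HasDerivAt (v ∘ e) (fderiv ℝ v (e t) (e 1)) t :=
      ((hv.differentiable one_ne_zero) (e t)).hasFDerivAt.comp_hasDerivAt t
        e.toContinuousLinearEquiv.toContinuousLinearMap.hasDerivAt
    rw [h.deriv]
    refine (ContinuousLinearMap.le_opENorm _ _).trans_eq ?_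
    rw [enorm_eq_nnnorm (e 1), e.nnnorm_map]
    simp
  calc ‖v x‖ₑ = ‖(v ∘ e) (e.symm x)‖ₑ := by simp
    _ ≤ ∫⁻ t in Iic (e.symm x), ‖deriv (v ∘ e) t‖ₑ :=
      hccomp.enorm_le_lintegral_Ici_deriv hcomp _
    _ ≤ ∫⁻ t, ‖deriv (v ∘ e) t‖ₑ := setLIntegral_le_lintegral _ _
    _ ≤ ∫⁻ t, ‖fderiv ℝ v (e t)‖ₑ := lintegral_mono hderiv
    _ = ∫⁻ y, ‖fderiv ℝ v y‖ₑ :=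
      e.measurePreserving.lintegral_comp_emb e.toMeasurableEquiv.measurableEmbedding
        (fun y => ‖fderiv ℝ v y‖ₑ)

/-- The `W^{1,1}` Sobolev inequality in dimension `n ≥ 1`, in dual form: pairing a compactly
supported `C¹` function with `f ^ (1 / n)`, where `f` is integrable. -/
theorem exists_lintegral_rpow_mul_enorm_le (n : ℕ) (hn : 1 ≤ n) :
    ∃ C : ℝ≥0, ∀ (v : EuclideanSpace ℝ (Fin n) → ℝ) (f : EuclideanSpace ℝ (Fin n) → ℝ≥0∞),
      ContDiff ℝ 1 v → HasCompactSupport v → Measurable f →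
        ∫⁻ x, f x ^ (1 / (n : ℝ)) * ‖v x‖ₑ ≤
          C * (∫⁻ x, f x) ^ (1 / (n : ℝ)) * ∫⁻ x, ‖fderiv ℝ v x‖ₑ := by
  rcases hn.eq_or_lt with rfl | hn
  · refine ⟨1, fun v f hv hcv hf => ?_⟩
    simp only [Nat.cast_one, div_one, ENNReal.rpow_one, ENNReal.coe_one, one_mul]
    rw [← lintegral_mul_const _ hf]
    gcongr with x
    exact enorm_le_lintegral_enorm_fderiv_of_fin_one hv hcv x
  · have hconj : Real.HolderConjugate (n : ℝ) (Real.conjExponent n) :=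
      .conjExponent (by exact_mod_cast hn)
    have hn0 : (n : ℝ) ≠ 0 := hconj.ne_zero
    set r := Real.conjExponent n
    have hr : 0 < r := hconj.symm.pos
    let K := lintegralPowLePowLIntegralFDerivConst
      (volume : Measure (EuclideanSpace ℝ (Fin n))) r
    refine ⟨K ^ (1 / r), fun v f hv hcv hf => ?_⟩
    have hvm : Measurable fun x => ‖v x‖ₑ := hv.continuous.measurable.enorm
    have hsob : ∫⁻ x, ‖v x‖ₑ ^ r ≤ K * (∫⁻ x, ‖fderiv ℝ v x‖ₑ) ^ r :=
      lintegral_pow_le_pow_lintegral_fderiv _ hv hcv (by simpa using hconj)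
    calc ∫⁻ x, f x ^ (1 / (n : ℝ)) * ‖v x‖ₑ
        ≤ (∫⁻ x, (f x ^ (1 / (n : ℝ))) ^ (n : ℝ)) ^ (1 / (n : ℝ)) *
            (∫⁻ x, ‖v x‖ₑ ^ r) ^ (1 / r) :=
          ENNReal.lintegral_mul_le_Lp_mul_Lq _ hconj (hf.pow_const _).aemeasurable
            hvm.aemeasurable
      _ ≤ (∫⁻ x, f x) ^ (1 / (n : ℝ)) * (K * (∫⁻ x, ‖fderiv ℝ v x‖ₑ) ^ r) ^ (1 / r) := by
          simp_rw [← ENNReal.rpow_mul, one_div_mul_cancel hn0, ENNReal.rpow_one]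
          gcongr
      _ = _ := by
          rw [ENNReal.mul_rpow_of_nonneg _ _ (by positivity), ← ENNReal.rpow_mul,
            mul_one_div_cancel hr.ne', ENNReal.rpow_one,
            ENNReal.coe_rpow_of_nonneg _ (by positivity)]
          ring

/-- The Gagliardo–Nirenberg inequality
`∫ |w| ^ (p (n + 2) / n) ≤ C (∫ |Dw| ^ p) (∫ |w| ^ 2) ^ (p / n)` for compactly supported `C¹`
functions on `ℝⁿ`. -/
theorem exists_lintegral_enorm_rpow_le (n : ℕ) (hn : 1 ≤ n) (p : ℝ) (hp : 1 < p) :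
    ∃ C : ℝ≥0, ∀ w : EuclideanSpace ℝ (Fin n) → ℝ, ContDiff ℝ 1 w → HasCompactSupport w →
      ∫⁻ x, ‖w x‖ₑ ^ (((n : ℝ) + 2) / n * p) ≤
        C * (∫⁻ x, ‖fderiv ℝ w x‖ₑ ^ p) * (∫⁻ x, ‖w x‖ₑ ^ (2 : ℝ)) ^ (p / (n : ℝ)) := by
  obtain ⟨C, hC⟩ := exists_lintegral_rpow_mul_enorm_le n hn
  have hn0 : (0 : ℝ) < n := by exact_mod_cast hn
  have hp0 : 0 < p := by linarith
  have hp1 : 0 < p - 1 := by linarith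
  let γ : ℝ≥0 := .mk (1 + (n + 2) * (p - 1) / n) (by positivity)
  have hγ : (γ : ℝ) = 1 + (n + 2) * (p - 1) / n := rfl
  have h1γ : 1 < (γ : ℝ) := by rw [hγ, lt_add_iff_pos_right]; positivity
  refine ⟨(C * γ) ^ p, fun w hw hcw => ?_⟩
  set q : ℝ := ((n : ℝ) + 2) / n * p with hq
  have hq0 : 0 < q := by positivity
  have hconj : p.HolderConjugate (Real.conjExponent p) := .conjExponent hp
  set p' := Real.conjExponent p with hp'
  have hγp : ((γ : ℝ) - 1) * p' = q := by
    rw [hγ, hp', Real.conjExponent, hq]; field_simp; ring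
  have hqγ : q = 2 * (1 / (n : ℝ)) + γ := by rw [hγ, hq]; field_simp; ring
  have hwm : Measurable fun x => ‖w x‖ₑ := hw.continuous.measurable.enorm
  have hdm : Measurable fun x => ‖fderiv ℝ w x‖ₑ :=
    (hw.continuous_fderiv one_ne_zero).measurable.enorm
  set X := ∫⁻ x, ‖w x‖ₑ ^ q with hX
  set A := ∫⁻ x, ‖w x‖ₑ ^ (2 : ℝ)
  set G := ∫⁻ x, ‖fderiv ℝ w x‖ₑ ^ p
  have hXtop : X ≠ ∞ := by
    have hmem : MemLp w (ENNReal.ofReal q) volume := hw.continuous.memLp_of_hasCompactSupport hcw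
    have h := lintegral_rpow_enorm_lt_top_of_eLpNorm_lt_top
      (by simpa using hq0) ENNReal.ofReal_ne_top hmem.eLpNorm_lt_top
    rw [ENNReal.toReal_ofReal hq0.le] at h
    exact h.ne
  by_cases hX0 : X = 0
  · simp [hX0]
  have hkey : X ≤ (C * γ * A ^ (1 / (n : ℝ)) * G ^ (1 / p)) * X ^ (1 / p') := calc
    X = ∫⁻ x, (‖w x‖ₑ ^ (2 : ℝ)) ^ (1 / (n : ℝ)) * ‖‖w x‖ ^ (γ : ℝ)‖ₑ := by
        refine lintegral_congr fun x => ?_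
        rw [Real.enorm_rpow_of_nonneg (norm_nonneg _) γ.coe_nonneg, enorm_norm, ← ENNReal.rpow_mul,
          ← ENNReal.rpow_add_of_nonneg _ _ (by positivity) γ.coe_nonneg, ← hqγ]
    _ ≤ C * A ^ (1 / (n : ℝ)) * ∫⁻ x, ‖fderiv ℝ (fun x => ‖w x‖ ^ (γ : ℝ)) x‖ₑ :=
        hC _ _ (hw.norm_rpow h1γ) (hcw.norm.rpow_const (by positivity)) (hwm.pow_const _)
    _ ≤ C * A ^ (1 / (n : ℝ)) * ∫⁻ x, γ * (‖w x‖ₑ ^ ((γ : ℝ) - 1) * ‖fderiv ℝ w x‖ₑ) := by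
        gcongr with x
        rw [← mul_assoc]
        exact enorm_fderiv_norm_rpow_le (hw.differentiable one_ne_zero) h1γ
    _ = C * A ^ (1 / (n : ℝ)) * (γ * ∫⁻ x, ‖fderiv ℝ w x‖ₑ * ‖w x‖ₑ ^ ((γ : ℝ) - 1)) := by
        rw [lintegral_const_mul' _ _ ENNReal.coe_ne_top]
        simp_rw [mul_comm (‖fderiv ℝ w _‖ₑ)]
    _ ≤ C * A ^ (1 / (n : ℝ)) * (γ * (G ^ (1 / p) *
          (∫⁻ x, (‖w x‖ₑ ^ ((γ : ℝ) - 1)) ^ p') ^ (1 / p'))) := by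
        gcongr
        exact ENNReal.lintegral_mul_le_Lp_mul_Lq _ hconj hdm.aemeasurable
          (hwm.pow_const _).aemeasurable
    _ = _ := by
        simp_rw [← ENNReal.rpow_mul, hγp, ← hX]
        ring
  have hXp : X ^ (1 / p) ≤ C * γ * A ^ (1 / (n : ℝ)) * G ^ (1 / p) := by
    have h : 1 / p = 1 - 1 / p' := by
      rw [one_div, one_div, hconj.symm.one_sub_inv]
    rw [h, ENNReal.rpow_sub _ _ hX0 hXtop, ENNReal.rpow_one]
    rw [← h]
    exact ENNReal.div_le_of_le_mul hkey
  calc X = (X ^ (1 / p)) ^ p := by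
        rw [← ENNReal.rpow_mul, one_div_mul_cancel hp0.ne', ENNReal.rpow_one]
    _ ≤ (C * γ * A ^ (1 / (n : ℝ)) * G ^ (1 / p)) ^ p := by gcongr
    _ = _ := by
        rw [ENNReal.mul_rpow_of_nonneg _ _ hp0.le, ENNReal.mul_rpow_of_nonneg _ _ hp0.le,
          ← ENNReal.rpow_mul, ← ENNReal.rpow_mul, one_div_mul_cancel hp0.ne', ENNReal.rpow_one,
          ENNReal.coe_rpow_of_nonneg _ hp0.le, ENNReal.coe_mul, one_div_mul_eq_div]
        ring

/-- Integrating a pointwise bound `F ≤ c G A ^ s` with `F` and `A` measurable and `A` finite,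
but without any measurability of `G`. -/
theorem lintegral_le_mul_lintegral_mul_essSup_rpow {α : Type*} [MeasurableSpace α]
    {μ : Measure α} {F G A : α → ℝ≥0∞} {c : ℝ≥0∞} {s : ℝ} (hc0 : c ≠ 0) (hc : c ≠ ∞)
    (hs : 0 < s) (hF : AEMeasurable F μ) (hA : AEMeasurable A μ) (hAtop : ∀ᵐ t ∂μ, A t ≠ ∞)
    (h : ∀ᵐ t ∂μ, F t ≤ c * G t * A t ^ s) :
    ∫⁻ t, F t ∂μ ≤ c * (∫⁻ t, G t ∂μ) * essSup A μ ^ s := by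
  by_cases hM : essSup A μ = ∞
  · by_cases hG : ∫⁻ t, G t ∂μ = 0
    · have hquot : ∫⁻ t, F t / (c * A t ^ s) ∂μ = 0 := by
        refine le_antisymm ((lintegral_mono_ae ?_).trans hG.le) zero_le
        filter_upwards [h] with t ht
        exact ENNReal.div_le_of_le_mul (ht.trans_eq (by ring))
      have hF0 : F =ᵐ[μ] 0 := by
        filter_upwards [(lintegral_eq_zero_iff' (hF.div ((hA.pow_const s).const_mul c))).1 hquot,
          hAtop] with t ht hAt
        rcases ENNReal.div_eq_zero_iff.1 ht with h0 | h0
        · exact h0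
        · exact absurd h0 (ENNReal.mul_ne_top hc (ENNReal.rpow_ne_top_of_nonneg hs.le hAt))
      rw [lintegral_eq_zero_of_ae_eq_zero hF0]
      exact zero_le
    · rw [hM, ENNReal.top_rpow_of_pos hs, ENNReal.mul_top (mul_ne_zero hc0 hG)]
      exact le_top
  · calc ∫⁻ t, F t ∂μ ≤ ∫⁻ t, c * essSup A μ ^ s * G t ∂μ := by
          refine lintegral_mono_ae ?_
          filter_upwards [h, ae_le_essSup (f := A) (μ := μ)] with t ht hAt
          calc F t ≤ c * G t * A t ^ s := ht
            _ ≤ c * G t * essSup A μ ^ s := by gcongr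
            _ = _ := by ring
      _ = c * essSup A μ ^ s * ∫⁻ t, G t ∂μ :=
          lintegral_const_mul' _ _
            (ENNReal.mul_ne_top hc (ENNReal.rpow_ne_top_of_nonneg hs.le hM))
      _ = _ := by ring

/-- Parabolic Sobolev inequality: with `κ = (n+2)/n` there is `c = c(n,p) > 0` such that for
every bounded open `U ⊂ ℝⁿ`, `0 < ε < T`, and measurable `u` with `u(·,t)` smooth and compactly
supported in `U` for a.e. `t ∈ (ε,T)`:
`∫_ε^T ∫_U |u|^{κp} ≤ c (∫_ε^T ∫_U |∇u|^p) (ess sup_{ε<t<T} ∫_U u² dx)^{p/n}`. -/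
theorem parabolic_sobolev (n : ℕ) (hn : 1 ≤ n) (p : ℝ) (hp1 : 1 < p) :
    ∃ c : ℝ, 0 < c ∧
      ∀ (U : Set (EuclideanSpace ℝ (Fin n))) (ε T : ℝ)
        (u : EuclideanSpace ℝ (Fin n) × ℝ → ℝ),
        IsOpen U → Bornology.IsBounded U → 0 < ε → ε < T →
        Measurable u →
        (∀ᵐ t ∂(volume.restrict (Set.Ioo ε T)),
          ContDiff ℝ (⊤ : ℕ∞) (fun x => u (x, t)) ∧ HasCompactSupport (fun x => u (x, t)) ∧
            tsupport (fun x => u (x, t)) ⊆ U) →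
        (∫⁻ t in Set.Ioo ε T, ∫⁻ x in U,
            ENNReal.ofReal (|u (x, t)| ^ (((n : ℝ) + 2) / n * p))) ≤
          ENNReal.ofReal c *
            (∫⁻ t in Set.Ioo ε T, ∫⁻ x in U,
              ENNReal.ofReal (‖gradient (fun y => u (y, t)) x‖ ^ p)) *
            (essSup (fun t => ENNReal.ofReal (∫ x in U, u (x, t) ^ 2))
              (volume.restrict (Set.Ioo ε T))) ^ (p / (n : ℝ)) := by
  obtain ⟨C, hC⟩ := exists_lintegral_enorm_rpow_le n hn p hp1
  have hn0 : (0 : ℝ) < n := by exact_mod_cast hn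
  have hp0 : 0 < p := by linarith
  refine ⟨C + 1, by positivity, fun U ε T u _ _ _ _ hu hreg => ?_⟩
  have hAe : ∀ᵐ t ∂(volume.restrict (Set.Ioo ε T)),
      ENNReal.ofReal (∫ x in U, u (x, t) ^ 2) = ∫⁻ x in U, ‖u (x, t)‖ₑ ^ (2 : ℝ) := by
    filter_upwards [hreg] with t ⟨hsm, hcs, _⟩
    have hsq : HasCompactSupport fun x => u (x, t) ^ 2 := by
      simp_rw [sq]
      exact hcs.mul_left
    have hint : Integrable (fun x => u (x, t) ^ 2) :=
      (hsm.continuous.pow 2).integrable_of_hasCompactSupport hsq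
    rw [ofReal_integral_eq_lintegral_ofReal hint.restrict (.of_forall fun x => sq_nonneg _)]
    refine lintegral_congr fun x => ?_
    rw [← sq_abs, ENNReal.ofReal_pow (abs_nonneg _), ← Real.enorm_eq_ofReal_abs]
    norm_cast
  refine lintegral_le_mul_lintegral_mul_essSup_rpow (by simp; positivity) ENNReal.ofReal_ne_top
    (by positivity) ?_ ?_ (.of_forall fun _ => ENNReal.ofReal_ne_top) ?_
  · refine Measurable.aemeasurable ?_
    exact Measurable.lintegral_prod_left' (f := fun z => ENNReal.ofReal (|u z| ^ _))
      ((hu.abs.pow_const _).ennreal_ofReal)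
  · refine AEMeasurable.congr ?_ (Filter.EventuallyEq.symm hAe)
    refine Measurable.aemeasurable ?_
    exact Measurable.lintegral_prod_left' (f := fun z => ‖u z‖ₑ ^ (2 : ℝ))
      (hu.enorm.pow_const _)
  · filter_upwards [hreg, hAe] with t ⟨hsm, hcs, hsupp⟩ hAt
    have hsupp' := (subset_tsupport fun x => u (x, t)).trans hsupp
    have hdsupp := (support_fderiv_subset ℝ (f := fun x => u (x, t))).trans hsupp
    have hpow (s : ℝ) (hs : 0 < s) :
        ∫⁻ x in U, ‖u (x, t)‖ₑ ^ s = ∫⁻ x, ‖u (x, t)‖ₑ ^ s := by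
      refine setLIntegral_eq_of_support_subset fun x hx => hsupp' fun h0 => hx ?_
      simp only at h0
      simp [h0, hs]
    have hgrad (x : EuclideanSpace ℝ (Fin n)) :
        ENNReal.ofReal (‖gradient (fun y => u (y, t)) x‖ ^ p) =
          ‖fderiv ℝ (fun y => u (y, t)) x‖ₑ ^ p := by
      rw [gradient, LinearIsometryEquiv.norm_map,
        ← ENNReal.ofReal_rpow_of_nonneg (norm_nonneg _) hp0.le, ofReal_norm]
    have habs (x : EuclideanSpace ℝ (Fin n)) :
        ENNReal.ofReal (|u (x, t)| ^ (((n : ℝ) + 2) / n * p)) =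
          ‖u (x, t)‖ₑ ^ (((n : ℝ) + 2) / n * p) := by
      rw [← ENNReal.ofReal_rpow_of_nonneg (abs_nonneg _) (by positivity),
        Real.enorm_eq_ofReal_abs]
    have hgradU : ∫⁻ x in U, ‖fderiv ℝ (fun y => u (y, t)) x‖ₑ ^ p =
        ∫⁻ x, ‖fderiv ℝ (fun y => u (y, t)) x‖ₑ ^ p := by
      refine setLIntegral_eq_of_support_subset fun x hx => hdsupp fun h0 => hx ?_
      simp [h0, hp0, enorm_eq_nnnorm]
    simp_rw [hAt, habs, hgrad]
    rw [hpow _ (by positivity), hpow _ two_pos, hgradU]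
    refine (hC _ (hsm.of_le (by exact_mod_cast le_top)) hcs).trans ?_
    gcongr
    rw [← ENNReal.ofReal_coe_nnreal]
    exact ENNReal.ofReal_le_ofReal (by linarith)
end

section
/- Let n ≥ 1 and p > 2, and for each exponent r > 2 let B_r denote the Barenblatt solution normalized so that ∫_{ℝⁿ} B_r(x,t) dx = 1 for all t > 0. Let U ⊂ ℝⁿ be a bounded open set and T > 0. Then for every q with 1 ≤ q < p − 1 + p/n, ∫_0^T ∫_U |B_{p̃}(x,t) − B_p(x,t)|^q dx dt → 0 as p̃ → p, and for every q with 1 ≤ q < p − 1 + 1/(n+1), ∫_0^T ∫_U |∇_x B_{p̃}(x,t) − ∇_x B_p(x,t)|^q dx dt → 0 as p̃ → p. -/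
open MeasureTheory Real Set Filter

/-- The Barenblatt solution of the `r`-parabolic equation with constant `C`:
`B_r(x,t) = t^{-n/λ} (C - ((r-2)/2) λ^{1/(1-r)} (|x| t^{-1/λ})^{r/(r-1)})_+^{(r-1)/(r-2)}`,
where `λ = λ(r) = n(r-2)+r`. -/
noncomputable def barenblatt (n : ℕ) (r C : ℝ) (x : EuclideanSpace ℝ (Fin n)) (t : ℝ) : ℝ :=
  t ^ (-(n : ℝ) / ((n : ℝ) * (r - 2) + r)) *
    (max (C - (r - 2) / 2 * ((n : ℝ) * (r - 2) + r) ^ (1 / (1 - r)) *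
      (‖x‖ / t ^ (1 / ((n : ℝ) * (r - 2) + r))) ^ (r / (r - 1))) 0) ^ ((r - 1) / (r - 2))

/-- The positive part raised to a power `s > 1` is differentiable everywhere. -/
lemma hasDerivAt_posPart_rpow {s : ℝ} (hs : 1 < s) (u : ℝ) :
    HasDerivAt (fun v : ℝ => max v 0 ^ s) (s * max u 0 ^ (s - 1)) u := by
  rcases lt_trichotomy u 0 with hu | rfl | hu
  · rw [max_eq_right hu.le, Real.zero_rpow (by linarith), mul_zero]
    refine (hasDerivAt_const u (0 : ℝ)).congr_of_eventuallyEq ?_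
    filter_upwards [Iio_mem_nhds hu] with v hv
    rw [max_eq_right (le_of_lt hv), Real.zero_rpow (by linarith)]
  · rw [max_self, ← hasDerivWithinAt_univ, ← Iic_union_Ici (a := (0 : ℝ))]
    refine HasDerivWithinAt.union ?_ ?_
    · rw [Real.zero_rpow (by linarith), mul_zero]
      refine (hasDerivWithinAt_const (0 : ℝ) _ (0 : ℝ)).congr_of_mem (fun v hv => ?_) (mem_Iic.2 le_rfl)
      rw [max_eq_right hv, Real.zero_rpow (by linarith)]
    · refine (Real.hasDerivAt_rpow_const (Or.inr hs.le)).hasDerivWithinAt.congr_of_mem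
        (fun v hv => ?_) (mem_Ici.2 le_rfl)
      rw [max_eq_left hv]
  · rw [max_eq_left hu.le]
    refine (Real.hasDerivAt_rpow_const (Or.inl hu.ne')).congr_of_eventuallyEq ?_
    filter_upwards [Ioi_mem_nhds hu] with v hv
    rw [max_eq_left (le_of_lt hv)]

section Profile

variable {E : Type*} [NormedAddCommGroup E]

/-- The radial profile `y ↦ (C - k |y|^m)_+^s`. -/
noncomputable def radialProfile (C k m s : ℝ) (y : E) : ℝ :=
  max (C - k * ‖y‖ ^ m) 0 ^ s

lemma posPart_le {C k a : ℝ} (hC : 0 < C) (hk : 0 ≤ k) (ha : 0 ≤ a) : max (C - k * a) 0 ≤ C :=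
  max_le (by nlinarith [mul_nonneg hk ha]) hC.le

lemma posPart_eq_zero_of_lt_norm {C k m : ℝ} (hC : 0 < C) (hk : 0 < k) (hm : 1 < m) {y : E}
    (hy : (C / k) ^ (1 / m) < ‖y‖) : max (C - k * ‖y‖ ^ m) 0 = 0 := by
  have h := Real.rpow_lt_rpow (by positivity) hy (show 0 < m by linarith)
  rw [← Real.rpow_mul (by positivity), one_div_mul_cancel (by linarith), Real.rpow_one,
    div_lt_iff₀ hk] at h
  exact max_eq_right (by linarith)

lemma radialProfile_eq_zero_of_lt_norm {C k m s : ℝ} (hC : 0 < C) (hk : 0 < k) (hm : 1 < m)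
    (hs : 1 < s) {y : E} (hy : (C / k) ^ (1 / m) < ‖y‖) : radialProfile C k m s y = 0 := by
  rw [radialProfile, posPart_eq_zero_of_lt_norm hC hk hm hy, Real.zero_rpow (by linarith)]

lemma norm_radialProfile_le {C k m s : ℝ} (hC : 0 < C) (hk : 0 ≤ k) (hs : 0 ≤ s) (y : E) :
    ‖radialProfile C k m s y‖ ≤ C ^ s := by
  rw [radialProfile, Real.norm_of_nonneg (by positivity)]
  exact Real.rpow_le_rpow (by positivity) (posPart_le hC hk (by positivity)) hs

lemma measurable_radialProfile [MeasurableSpace E] [BorelSpace E] (C k m s : ℝ) :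
    Measurable (radialProfile C k m s : E → ℝ) := by
  unfold radialProfile
  fun_prop

section Limits

variable {ι : Type*} {l : Filter ι} {C k m s : ι → ℝ} {Y : ι → E} {C₀ k₀ m₀ s₀ : ℝ} {y₀ : E}

lemma tendsto_posPart (hC : Tendsto C l (nhds C₀)) (hk : Tendsto k l (nhds k₀))
    (hm : Tendsto m l (nhds m₀)) (hY : Tendsto Y l (nhds y₀)) (hm₀ : 1 < m₀) :
    Tendsto (fun i => max (C i - k i * ‖Y i‖ ^ m i) 0) l
      (nhds (max (C₀ - k₀ * ‖y₀‖ ^ m₀) 0)) :=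
  (hC.sub (hk.mul (hY.norm.rpow hm (Or.inr (by linarith))))).max tendsto_const_nhds

lemma tendsto_radialProfile (hC : Tendsto C l (nhds C₀)) (hk : Tendsto k l (nhds k₀))
    (hm : Tendsto m l (nhds m₀)) (hs : Tendsto s l (nhds s₀)) (hY : Tendsto Y l (nhds y₀))
    (hm₀ : 1 < m₀) (hs₀ : 1 < s₀) :
    Tendsto (fun i => radialProfile (C i) (k i) (m i) (s i) (Y i)) l
      (nhds (radialProfile C₀ k₀ m₀ s₀ y₀)) :=
  (tendsto_posPart hC hk hm hY hm₀).rpow hs (Or.inr (by linarith))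

end Limits

variable [InnerProductSpace ℝ E]

/-- The gradient of `radialProfile`. -/
noncomputable def radialProfileGrad (C k m s : ℝ) (y : E) : E :=
  (-(s * k * m * max (C - k * ‖y‖ ^ m) 0 ^ (s - 1) * ‖y‖ ^ (m - 2))) • y

lemma hasGradientAt_radialProfile [CompleteSpace E] {C k m s : ℝ} (hm : 1 < m) (hs : 1 < s)
    (y : E) :
    HasGradientAt (radialProfile C k m s) (radialProfileGrad C k m s y) y := by
  have h := ((hasDerivAt_posPart_rpow hs (C - k * ‖y‖ ^ m)).comp_hasFDerivAt y
    (((hasFDerivAt_norm_rpow y hm).const_mul k).const_sub C))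
  rw [hasGradientAt_iff_hasFDerivAt]
  refine h.congr_fderiv ?_
  ext z
  simp [radialProfileGrad]
  ring

lemma norm_radialProfileGrad {C k m s : ℝ} (hk : 0 ≤ k) (hm : 1 < m) (hs : 1 < s) (y : E) :
    ‖radialProfileGrad C k m s y‖ =
      s * k * m * max (C - k * ‖y‖ ^ m) 0 ^ (s - 1) * ‖y‖ ^ (m - 1) := by
  have h0 : 0 ≤ s * k * m * max (C - k * ‖y‖ ^ m) 0 ^ (s - 1) * ‖y‖ ^ (m - 2) := by positivity
  rw [radialProfileGrad, norm_smul, norm_neg, Real.norm_of_nonneg h0]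
  rcases eq_or_ne y 0 with rfl | hy
  · simp [Real.zero_rpow (show m - 1 ≠ 0 by linarith)]
  · rw [mul_assoc, ← Real.rpow_add_one (norm_ne_zero_iff.2 hy)]
    ring_nf

lemma radialProfileGrad_eq_zero_of_lt_norm {C k m s : ℝ} (hC : 0 < C) (hk : 0 < k) (hm : 1 < m)
    (hs : 1 < s) {y : E} (hy : (C / k) ^ (1 / m) < ‖y‖) : radialProfileGrad C k m s y = 0 := by
  simp [radialProfileGrad, posPart_eq_zero_of_lt_norm hC hk hm hy,
    Real.zero_rpow (show s - 1 ≠ 0 by linarith)]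

lemma norm_radialProfileGrad_le {C k m s : ℝ} (hC : 0 < C) (hk : 0 < k) (hm : 1 < m) (hs : 1 < s)
    (y : E) :
    ‖radialProfileGrad C k m s y‖ ≤
      s * k * m * C ^ (s - 1) * ((C / k) ^ (1 / m)) ^ (m - 1) := by
  rcases le_or_gt ‖y‖ ((C / k) ^ (1 / m)) with hy | hy
  · rw [norm_radialProfileGrad hk.le hm hs]
    have h1 : max (C - k * ‖y‖ ^ m) 0 ^ (s - 1) ≤ C ^ (s - 1) :=
      Real.rpow_le_rpow (by positivity) (posPart_le hC hk.le (by positivity)) (by linarith)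
    have h2 : ‖y‖ ^ (m - 1) ≤ ((C / k) ^ (1 / m)) ^ (m - 1) :=
      Real.rpow_le_rpow (by positivity) hy (by linarith)
    gcongr
  · rw [radialProfileGrad_eq_zero_of_lt_norm hC hk hm hs hy, norm_zero]
    positivity

section Limits

variable {ι : Type*} {l : Filter ι} {C k m s : ι → ℝ} {Y : ι → E} {C₀ k₀ m₀ s₀ : ℝ} {y₀ : E}

lemma tendsto_radialProfileGrad (hC : Tendsto C l (nhds C₀)) (hk : Tendsto k l (nhds k₀))
    (hm : Tendsto m l (nhds m₀)) (hs : Tendsto s l (nhds s₀)) (hY : Tendsto Y l (nhds y₀))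
    (hk₀ : 0 < k₀) (hm₀ : 1 < m₀) (hs₀ : 1 < s₀) :
    Tendsto (fun i => radialProfileGrad (C i) (k i) (m i) (s i) (Y i)) l
      (nhds (radialProfileGrad C₀ k₀ m₀ s₀ y₀)) := by
  have hP := (tendsto_posPart hC hk hm hY hm₀).rpow (hs.sub_const 1) (Or.inr (by linarith))
  rcases eq_or_ne y₀ 0 with rfl | hy
  · have h0 : radialProfileGrad C₀ k₀ m₀ s₀ (0 : E) = 0 := smul_zero _
    rw [h0, tendsto_zero_iff_norm_tendsto_zero]
    have h := (((hs.mul hk).mul hm).mul hP).mul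
      (hY.norm.rpow (hm.sub_const 1) (Or.inr (by linarith)))
    rw [norm_zero, Real.zero_rpow (show m₀ - 1 ≠ 0 by linarith), mul_zero] at h
    refine h.congr' ?_
    filter_upwards [hk.eventually_const_lt hk₀, hm.eventually_const_lt hm₀,
      hs.eventually_const_lt hs₀] with i h1 h2 h3
    rw [norm_radialProfileGrad h1.le h2 h3]
  · exact ((((hs.mul hk).mul hm).mul hP).mul
      (hY.norm.rpow (hm.sub_const 2) (Or.inl (norm_ne_zero_iff.2 hy)))).neg.smul hY

end Limits

lemma measurable_radialProfileGrad [MeasurableSpace E] [BorelSpace E]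
    [SecondCountableTopology E] (C k m s : ℝ) :
    Measurable (radialProfileGrad C k m s : E → E) := by
  unfold radialProfileGrad
  fun_prop

end Profile

section SelfSimilar

variable {E : Type*} [NormedAddCommGroup E] [NormedSpace ℝ E] [FiniteDimensional ℝ E]
  [MeasurableSpace E] [BorelSpace E] (μ : Measure E) [μ.IsAddHaarMeasure]

/-- Dominated convergence for iterated integrals of functions supported in the thin region
`‖x‖ ≤ R t ^ β` and bounded by a power of `t`. -/
lemma tendsto_iterated_integral_zero {ι : Type*} {l : Filter ι} [l.IsCountablyGenerated]
    {h : ι → ℝ → E → ℝ} {T K R β γ : ℝ} (U : Set E) (hT : 0 < T) (hK : 0 ≤ K) (hR : 0 ≤ R)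
    (hγ : γ - Module.finrank ℝ E * β < 1)
    (hmeas : ∀ i, Measurable (Function.uncurry (h i)))
    (hbd : ∀ᶠ i in l, ∀ t ∈ Ioo 0 T, ∀ x,
      ‖h i t x‖ ≤ (Metric.closedBall 0 (R * t ^ β)).indicator (fun _ => K * t ^ (-γ)) x)
    (hlim : ∀ t ∈ Ioo 0 T, ∀ x, Tendsto (fun i => h i t x) l (nhds 0)) :
    Tendsto (fun i => ∫ t in Ioo 0 T, ∫ x in U, h i t x ∂μ) l (nhds 0) := by
  have hint : ∀ t, Integrable
      ((Metric.closedBall (0 : E) (R * t ^ β)).indicator fun _ => K * t ^ (-γ)) μ := fun t =>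
    (integrable_indicator_iff measurableSet_closedBall).2
      (integrableOn_const (isCompact_closedBall _ _).measure_lt_top.ne)
  set d := Module.finrank ℝ E
  have key : Tendsto (fun i => ∫ t in Ioo 0 T, ∫ x in U, h i t x ∂μ) l
      (nhds (∫ _t in Ioo 0 T, (0 : ℝ))) := by
    refine tendsto_integral_filter_of_dominated_convergence
      (fun t => μ.real (Metric.ball 0 1) * R ^ d * K * t ^ (d * β - γ)) ?_ ?_ ?_ ?_
    · refine Eventually.of_forall fun i => ?_
      exact ((hmeas i).stronglyMeasurable.integral_prod_right
        (ν := μ.restrict U)).aestronglyMeasurable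
    · filter_upwards [hbd] with i hi
      filter_upwards [ae_restrict_mem measurableSet_Ioo] with t ht
      refine (norm_integral_le_of_norm_le (hint t).integrableOn
        (Eventually.of_forall (hi t ht))).trans ?_
      have ht0 : 0 < t := ht.1
      refine (setIntegral_le_integral (hint t) (Eventually.of_forall fun x =>
        indicator_nonneg (fun _ _ => by positivity) x)).trans (le_of_eq ?_)
      rw [integral_indicator measurableSet_closedBall, setIntegral_const, smul_eq_mul,
        Measure.real, Measure.addHaar_closedBall μ 0 (by positivity), ENNReal.toReal_mul,
        ENNReal.toReal_ofReal (by positivity), mul_pow, ← Real.rpow_mul_natCast ht0.le,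
        sub_eq_add_neg, Real.rpow_add ht0, mul_comm β, Measure.real]
      ring
    · have := (intervalIntegrable_iff_integrableOn_Ioo_of_le hT.le).1
        (intervalIntegral.intervalIntegrable_rpow' (a := 0) (b := T)
          (show -1 < d * β - γ by linarith))
      exact this.const_mul _
    · filter_upwards [ae_restrict_mem measurableSet_Ioo] with t ht
      have : Tendsto (fun i => ∫ x in U, h i t x ∂μ) l (nhds (∫ _x in U, (0 : ℝ) ∂μ)) := by
        refine tendsto_integral_filter_of_dominated_convergence _ ?_ ?_
          (hint t).integrableOn (Eventually.of_forall (hlim t ht))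
        · exact Eventually.of_forall fun i =>
            ((hmeas i).comp measurable_prodMk_left).aestronglyMeasurable
        · filter_upwards [hbd] with i hi
          exact Eventually.of_forall (hi t ht)
      simpa using this
  simpa using key

/-- Stability in `L^q` of self-similar families `t ^ (-N b) φ (t ^ (-b) x)`. -/
lemma tendsto_selfSimilar {F : Type*} [NormedAddCommGroup F] [NormedSpace ℝ F]
    [MeasurableSpace F] [BorelSpace F] [SecondCountableTopology F]
    {φ : ℝ → E → F} {b : ℝ → ℝ} {p T M R N q : ℝ} (U : Set E) (hT : 0 < T) (hR : 0 ≤ R)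
    (hN : 0 ≤ N) (hq : 1 ≤ q) (hb : ContinuousAt b p) (hbp : 0 < b p)
    (hNq : N * q * b p - Module.finrank ℝ E * b p < 1)
    (hmeas : ∀ r, Measurable (φ r))
    (hM : ∀ᶠ r in nhds p, ∀ y, ‖φ r y‖ ≤ M)
    (hsupp : ∀ᶠ r in nhds p, ∀ y, R < ‖y‖ → φ r y = 0)
    (hlim : ∀ (c : ℝ → ℝ) (x : E), ContinuousAt c p →
      Tendsto (fun r => φ r (c r • x)) (nhds p) (nhds (φ p (c p • x)))) :
    Tendsto (fun r => ∫ t in Ioo 0 T, ∫ x in U,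
      ‖t ^ (-(N * b r)) • φ r (t ^ (-b r) • x) - t ^ (-(N * b p)) • φ p (t ^ (-b p) • x)‖ ^ q ∂μ)
      (nhds p) (nhds 0) := by
  have hM0 : 0 ≤ M := (norm_nonneg _).trans (hM.self_of_nhds 0)
  set d := Module.finrank ℝ E
  obtain ⟨ε, hε, hε0, hεb⟩ :
      ∃ ε : ℝ, N * (b p + ε) * q - d * (b p - ε) < 1 ∧ 0 < ε ∧ ε < b p := by
    have hc : Tendsto (fun ε : ℝ => N * (b p + ε) * q - d * (b p - ε)) (nhds 0)
        (nhds (N * (b p + 0) * q - d * (b p - 0))) :=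
      Continuous.tendsto (by fun_prop) 0
    have hlt : N * (b p + 0) * q - d * (b p - 0) < 1 := by
      rwa [add_zero, sub_zero, mul_right_comm]
    have h1 : ∀ᶠ ε in nhdsWithin (0 : ℝ) (Ioi 0), N * (b p + ε) * q - d * (b p - ε) < 1 :=
      (hc.mono_left nhdsWithin_le_nhds).eventually_lt_const hlt
    obtain ⟨ε, h⟩ := (h1.and (Ioo_mem_nhdsGT hbp)).exists
    exact ⟨ε, h.1, h.2.1, h.2.2⟩
  set S := max T 1
  have hS : 1 ≤ S := le_max_right _ _
  have hpow : ∀ t ∈ Ioo 0 T, ∀ e A : ℝ, 0 ≤ e → e ≤ A → t ^ e ≤ S ^ A := fun t ht e A he heA =>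
    (Real.rpow_le_rpow ht.1.le (ht.2.le.trans (le_max_left _ _)) he).trans
      (Real.rpow_le_rpow_of_exponent_le hS heA)
  have hpt : ∀ᶠ r in nhds p, ∀ t ∈ Ioo 0 T, ∀ x : E,
      ‖t ^ (-(N * b r)) • φ r (t ^ (-b r) • x)‖ ≤
        (Metric.closedBall 0 (R * S ^ (2 * ε) * t ^ (b p - ε))).indicator
          (fun _ => M * S ^ (2 * N * ε) * t ^ (-(N * (b p + ε)))) x := by
    filter_upwards [hM, hsupp, hb.eventually (Ioo_mem_nhds (show b p - ε < b p by linarith)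
      (show b p < b p + ε by linarith))] with r hMr hsr hbr t ht x
    have ht0 : 0 < t := ht.1
    by_cases hx : x ∈ Metric.closedBall (0 : E) (R * S ^ (2 * ε) * t ^ (b p - ε))
    · rw [indicator_of_mem hx, norm_smul, Real.norm_of_nonneg (by positivity)]
      have h1 : t ^ (-(N * b r)) ≤ S ^ (2 * N * ε) * t ^ (-(N * (b p + ε))) := by
        have : -(N * b r) = N * (b p + ε - b r) + -(N * (b p + ε)) := by ring
        rw [this, Real.rpow_add ht0]
        gcongr
        refine hpow t ht _ _ (mul_nonneg hN (by linarith [hbr.2])) ?_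
        nlinarith [hbr.1]
      calc t ^ (-(N * b r)) * ‖φ r (t ^ (-b r) • x)‖
          ≤ S ^ (2 * N * ε) * t ^ (-(N * (b p + ε))) * M := by gcongr; exact hMr _
        _ = _ := by ring
    · rw [indicator_of_notMem hx, hsr, smul_zero, norm_zero]
      rw [mem_closedBall_zero_iff, not_le] at hx
      rw [norm_smul, Real.norm_of_nonneg (by positivity), Real.rpow_neg ht0.le,
        inv_mul_eq_div, lt_div_iff₀ (by positivity)]
      refine lt_of_le_of_lt ?_ hx
      rw [mul_assoc]
      gcongr
      have : b r = (b r - (b p - ε)) + (b p - ε) := by ring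
      rw [this, Real.rpow_add ht0]
      gcongr
      exact hpow t ht _ _ (by linarith [hbr.1]) (by linarith [hbr.2])
  have hptp := hpt.self_of_nhds
  refine tendsto_iterated_integral_zero μ U hT (K := (2 * (M * S ^ (2 * N * ε))) ^ q)
    (R := R * S ^ (2 * ε)) (β := b p - ε) (γ := N * (b p + ε) * q)
    (by positivity) (by positivity) hε ?_ ?_ ?_
  · intro r
    have hφ : ∀ r, Measurable fun z : ℝ × E => z.1 ^ (-(N * b r)) • φ r (z.1 ^ (-b r) • z.2) :=
      fun r => Measurable.smul (by fun_prop) ((hmeas r).comp (by fun_prop))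
    exact ((hφ r).sub (hφ p)).norm.pow_const q
  · filter_upwards [hpt] with r hr t ht x
    have ht0 : 0 < t := ht.1
    have h1 := hr t ht x
    have h2 := hptp t ht x
    rw [Real.norm_of_nonneg (by positivity)]
    by_cases hx : x ∈ Metric.closedBall (0 : E) (R * S ^ (2 * ε) * t ^ (b p - ε))
    · rw [indicator_of_mem hx] at h1 h2 ⊢
      calc _ ≤ (2 * (M * S ^ (2 * N * ε)) * t ^ (-(N * (b p + ε)))) ^ q := by
            refine Real.rpow_le_rpow (norm_nonneg _) ((norm_sub_le _ _).trans ?_) (by linarith)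
            linarith
        _ = _ := by
          rw [Real.mul_rpow (by positivity) (by positivity), ← Real.rpow_mul ht0.le, neg_mul]
    · rw [indicator_of_notMem hx] at h1 h2 ⊢
      rw [norm_le_zero_iff.1 h1, norm_le_zero_iff.1 h2, sub_zero, norm_zero,
        Real.zero_rpow (by linarith)]
  · intro t ht x
    have hc : ∀ N' : ℝ, ContinuousAt (fun r => t ^ (-(N' * b r))) p := fun N' =>
      ContinuousAt.rpow continuousAt_const (hb.const_mul N').neg (Or.inl ht.1.ne')
    have h1 : Tendsto (fun r => t ^ (-(N * b r)) • φ r (t ^ (-b r) • x)) (nhds p)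
        (nhds (t ^ (-(N * b p)) • φ p (t ^ (-b p) • x))) := by
      refine (hc N).tendsto.smul (hlim (fun r => t ^ (-b r)) x ?_)
      simpa using hc 1
    have h2 := ((h1.sub_const (t ^ (-(N * b p)) • φ p (t ^ (-b p) • x))).norm).rpow_const
      (p := q) (Or.inr (by linarith))
    simpa [Real.zero_rpow (show q ≠ 0 by linarith)] using h2

end SelfSimilar

section Barenblatt

/-- The scaling exponent `λ(r) = n (r - 2) + r`. -/
noncomputable def barenblattLam (n : ℕ) (r : ℝ) : ℝ := n * (r - 2) + r

/-- The coefficient `((r - 2) / 2) λ(r) ^ (1 / (1 - r))`. -/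
noncomputable def barenblattCoef (n : ℕ) (r : ℝ) : ℝ :=
  (r - 2) / 2 * barenblattLam n r ^ (1 / (1 - r))

variable {n : ℕ} {r p : ℝ}

lemma barenblattLam_pos (n : ℕ) (hr : 2 < r) : 0 < barenblattLam n r := by
  have := mul_nonneg n.cast_nonneg (sub_nonneg.2 hr.le)
  rw [barenblattLam]
  linarith

lemma barenblattCoef_pos (n : ℕ) (hr : 2 < r) : 0 < barenblattCoef n r :=
  mul_pos (by linarith) (Real.rpow_pos_of_pos (barenblattLam_pos n hr) _)

lemma one_lt_div_sub_one (hr : 2 < r) : 1 < r / (r - 1) := by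
  rw [one_lt_div] <;> linarith

lemma one_lt_sub_one_div_sub_two (hr : 2 < r) : 1 < (r - 1) / (r - 2) := by
  rw [one_lt_div] <;> linarith

lemma continuousAt_barenblattLam (n : ℕ) (p : ℝ) : ContinuousAt (barenblattLam n) p := by
  unfold barenblattLam
  fun_prop

lemma continuousAt_barenblattCoef (n : ℕ) (hp : 2 < p) : ContinuousAt (barenblattCoef n) p := by
  refine ContinuousAt.mul (by fun_prop) ((continuousAt_barenblattLam n p).rpow ?_
    (Or.inl (barenblattLam_pos n hp).ne'))
  exact continuousAt_const.div (by fun_prop) (by linarith)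

lemma continuousAt_div_sub_one (hp : 2 < p) : ContinuousAt (fun r : ℝ => r / (r - 1)) p :=
  continuousAt_id.div (by fun_prop) (by linarith)

lemma continuousAt_sub_one_div_sub_two (hp : 2 < p) :
    ContinuousAt (fun r : ℝ => (r - 1) / (r - 2)) p :=
  ContinuousAt.div (by fun_prop) (by fun_prop) (by linarith)

lemma barenblatt_eq (C : ℝ) (x : EuclideanSpace ℝ (Fin n)) {t : ℝ} (ht : 0 < t) :
    barenblatt n r C x t = t ^ (-(n * (1 / barenblattLam n r))) •
      radialProfile C (barenblattCoef n r) (r / (r - 1)) ((r - 1) / (r - 2))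
        (t ^ (-(1 / barenblattLam n r)) • x) := by
  rw [barenblatt, radialProfile, norm_smul, Real.norm_of_nonneg (by positivity),
    Real.rpow_neg ht.le (1 / barenblattLam n r), inv_mul_eq_div, smul_eq_mul, mul_one_div, neg_div]
  rfl

lemma gradient_barenblatt (hr : 2 < r) (C : ℝ) (x : EuclideanSpace ℝ (Fin n)) {t : ℝ}
    (ht : 0 < t) :
    gradient (fun y => barenblatt n r C y t) x =
      t ^ (-((n + 1) * (1 / barenblattLam n r))) •
      radialProfileGrad C (barenblattCoef n r) (r / (r - 1)) ((r - 1) / (r - 2))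
        (t ^ (-(1 / barenblattLam n r)) • x) := by
  have hpow : t ^ (-((n + 1) * (1 / barenblattLam n r))) =
      t ^ (-(n * (1 / barenblattLam n r))) * t ^ (-(1 / barenblattLam n r)) := by
    rw [← Real.rpow_add ht]
    ring_nf
  rw [funext fun y => barenblatt_eq C y ht, hpow]
  set c := t ^ (-(1 / barenblattLam n r))
  refine HasGradientAt.gradient ?_
  have h := hasGradientAt_iff_hasFDerivAt.1 (hasGradientAt_radialProfile (C := C)
    (k := barenblattCoef n r) (one_lt_div_sub_one hr) (one_lt_sub_one_div_sub_two hr) (c • x))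
  have h2 := (h.comp x ((hasFDerivAt_id x).const_smul c)).const_smul
    (t ^ (-(n * (1 / barenblattLam n r))))
  rw [hasGradientAt_iff_hasFDerivAt]
  refine h2.congr_fderiv ?_
  ext z
  simp
  ring

/-- The normalization condition, with the dependence on the constant scaled out. -/
lemma barenblatt_normalization {C : ℝ} (hC : 0 < C) (hr : 2 < r)
    (h : ∫ x, barenblatt n r C x 1 = 1) :
    C ^ ((r - 1) / (r - 2)) * (C / barenblattCoef n r) ^ (n / (r / (r - 1))) *
      ∫ z : EuclideanSpace ℝ (Fin n), radialProfile 1 1 (r / (r - 1)) ((r - 1) / (r - 2)) z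
        = 1 := by
  have hk := barenblattCoef_pos n hr
  have hm := one_lt_div_sub_one hr
  set k := barenblattCoef n r
  set m := r / (r - 1)
  set s := (r - 1) / (r - 2)
  set ρ := (C / k) ^ (1 / m)
  have hρ : 0 < ρ := by positivity
  have hρm : ρ ^ m = C / k := by
    rw [← Real.rpow_mul (by positivity), one_div_mul_cancel (by linarith), Real.rpow_one]
  have hscale : ∀ z : EuclideanSpace ℝ (Fin n),
      barenblatt n r C (ρ • z) 1 = C ^ s * radialProfile 1 1 m s z := by
    intro z
    rw [barenblatt_eq C _ one_pos, Real.one_rpow, one_smul, Real.one_rpow, one_smul,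
      radialProfile, radialProfile, norm_smul, Real.norm_of_nonneg hρ.le,
      Real.mul_rpow hρ.le (norm_nonneg _), hρm, ← Real.mul_rpow hC.le (by positivity),
      mul_max_of_nonneg _ _ hC.le, mul_zero]
    congr 2
    change C - k * (C / k * ‖z‖ ^ m) = _
    field_simp
  have h1 := Measure.integral_comp_smul volume
    (fun x : EuclideanSpace ℝ (Fin n) => barenblatt n r C x 1) ρ
  simp only [hscale] at h1
  rw [h, integral_const_mul, finrank_euclideanSpace_fin, abs_of_pos (by positivity), smul_eq_mul,
    mul_one] at h1
  have h2 : (C / k) ^ (n / m) = ρ ^ n := by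
    rw [← Real.rpow_mul_natCast (by positivity)]
    ring_nf
  rw [mul_right_comm, h1, h2, inv_mul_cancel₀ (by positivity)]

lemma continuousAt_integral_radialProfile (hp : 2 < p) :
    ContinuousAt (fun r : ℝ => ∫ z : EuclideanSpace ℝ (Fin n),
      radialProfile 1 1 (r / (r - 1)) ((r - 1) / (r - 2)) z) p := by
  refine tendsto_integral_filter_of_dominated_convergence
    ((Metric.closedBall 0 1).indicator fun _ => 1)
    (Eventually.of_forall fun r => (measurable_radialProfile _ _ _ _).aestronglyMeasurable) ?_
    ((integrable_indicator_iff measurableSet_closedBall).2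
      (integrableOn_const (isCompact_closedBall _ _).measure_lt_top.ne)) ?_
  · filter_upwards [Ioi_mem_nhds hp] with r hr
    have hm := one_lt_div_sub_one hr
    have hs := one_lt_sub_one_div_sub_two hr
    refine Eventually.of_forall fun z => ?_
    by_cases hz : z ∈ Metric.closedBall (0 : EuclideanSpace ℝ (Fin n)) 1
    · rw [indicator_of_mem hz]
      simpa using norm_radialProfile_le one_pos zero_le_one (by linarith) z
    · rw [indicator_of_notMem hz]
      rw [mem_closedBall_zero_iff, not_le] at hz
      rw [radialProfile_eq_zero_of_lt_norm one_pos one_pos hm hs (by simpa using hz), norm_zero]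
  · exact Eventually.of_forall fun z => tendsto_radialProfile tendsto_const_nhds
      tendsto_const_nhds (continuousAt_div_sub_one hp) (continuousAt_sub_one_div_sub_two hp)
      tendsto_const_nhds (one_lt_div_sub_one hp) (one_lt_sub_one_div_sub_two hp)

/-- The normalizing constants depend continuously on the exponent. -/
lemma continuousAt_of_barenblatt_normalized (hp : 2 < p) {Cfun : ℝ → ℝ}
    (hCfun : ∀ r : ℝ, 2 < r → 0 < Cfun r ∧
      ∀ t : ℝ, 0 < t → ∫ x, barenblatt n r (Cfun r) x t = 1) :
    ContinuousAt Cfun p := by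
  set I : ℝ → ℝ := fun r => ∫ z : EuclideanSpace ℝ (Fin n),
    radialProfile 1 1 (r / (r - 1)) ((r - 1) / (r - 2)) z
  set e : ℝ → ℝ := fun r => n / (r / (r - 1))
  set G : ℝ → ℝ := fun r => (barenblattCoef n r ^ e r / I r) ^ (1 / ((r - 1) / (r - 2) + e r))
  have hnorm : ∀ r, 2 < r → Cfun r ^ ((r - 1) / (r - 2)) *
      (Cfun r / barenblattCoef n r) ^ e r * I r = 1 := fun r hr =>
    barenblatt_normalization (hCfun r hr).1 hr ((hCfun r hr).2 1 one_pos)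
  have hI : ∀ r, 2 < r → I r ≠ 0 := fun r hr h => by
    have := hnorm r hr
    rw [h, mul_zero] at this
    exact zero_ne_one this
  have he : ∀ r, 2 < r → 0 < (r - 1) / (r - 2) + e r := fun r hr => by
    have h1 := one_lt_sub_one_div_sub_two hr
    have h2 := one_lt_div_sub_one hr
    have h3 : 0 ≤ e r := by positivity
    linarith
  have heq : ∀ r, 2 < r → G r = Cfun r := fun r hr => by
    have hC := (hCfun r hr).1
    have hk := barenblattCoef_pos n hr
    have hke : 0 < barenblattCoef n r ^ e r := by positivity
    have h := hnorm r hr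
    rw [Real.div_rpow hC.le hk.le, mul_div_assoc', ← Real.rpow_add hC, div_mul_eq_mul_div,
      div_eq_one_iff_eq hke.ne'] at h
    have h' : barenblattCoef n r ^ e r / I r = Cfun r ^ ((r - 1) / (r - 2) + e r) := by
      rw [← h, mul_div_cancel_right₀ _ (hI r hr)]
    change (barenblattCoef n r ^ e r / I r) ^ (1 / ((r - 1) / (r - 2) + e r)) = _
    rw [h', ← Real.rpow_mul hC.le, mul_one_div_cancel (he r hr).ne', Real.rpow_one]
  have hcont : ContinuousAt G p := by
    have hec : ContinuousAt e p := continuousAt_const.div (continuousAt_div_sub_one hp)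
      (by linarith [one_lt_div_sub_one hp])
    have hk := barenblattCoef_pos n hp
    refine ContinuousAt.rpow (((continuousAt_barenblattCoef n hp).rpow hec (Or.inl hk.ne')).div
      (continuousAt_integral_radialProfile hp) (hI p hp))
      (continuousAt_const.div ((continuousAt_sub_one_div_sub_two hp).add hec) (he p hp).ne')
      (Or.inl (div_ne_zero (by positivity) (hI p hp)))
  refine hcont.congr ?_
  filter_upwards [Ioi_mem_nhds hp] with r hr using heq r hr

end Barenblatt

/-- Stability of the normalized Barenblatt solutions in the exponent: if for each `r > 2`
the constant `Cfun r > 0` normalizes `∫_{ℝⁿ} B_r(x,t) dx = 1` for all `t > 0`, then for a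
bounded open `U` and `T > 0`,
`∫_0^T ∫_U |B_{p̃} − B_p|^q → 0` as `p̃ → p` for every `1 ≤ q < p − 1 + p/n`, and
`∫_0^T ∫_U |∇_x B_{p̃} − ∇_x B_p|^q → 0` as `p̃ → p` for every `1 ≤ q < p − 1 + 1/(n+1)`. -/
theorem barenblatt_stability (n : ℕ) (hn : 1 ≤ n) (p : ℝ) (hp : 2 < p)
    (U : Set (EuclideanSpace ℝ (Fin n))) (hUo : IsOpen U) (hUb : Bornology.IsBounded U)
    (T : ℝ) (hT : 0 < T) (Cfun : ℝ → ℝ)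
    (hCfun : ∀ r : ℝ, 2 < r → 0 < Cfun r ∧
      ∀ t : ℝ, 0 < t → ∫ x, barenblatt n r (Cfun r) x t = 1) :
    (∀ q : ℝ, 1 ≤ q → q < p - 1 + p / n →
      Tendsto (fun r => ∫ t in Set.Ioo (0 : ℝ) T, ∫ x in U,
          |barenblatt n r (Cfun r) x t - barenblatt n p (Cfun p) x t| ^ q)
        (nhdsWithin p (Set.Ioi 2)) (nhds 0)) ∧
    (∀ q : ℝ, 1 ≤ q → q < p - 1 + 1 / (n + 1) →
      Tendsto (fun r => ∫ t in Set.Ioo (0 : ℝ) T, ∫ x in U,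
          ‖gradient (fun y => barenblatt n r (Cfun r) y t) x -
            gradient (fun y => barenblatt n p (Cfun p) y t) x‖ ^ q)
        (nhdsWithin p (Set.Ioi 2)) (nhds 0)) := by
  have hcC := continuousAt_of_barenblatt_normalized hp hCfun
  have hck := continuousAt_barenblattCoef n hp
  have hcm := continuousAt_div_sub_one hp
  have hcs := continuousAt_sub_one_div_sub_two hp
  have hΛ := barenblattLam_pos n hp
  have hk := barenblattCoef_pos n hp
  have hm := one_lt_div_sub_one hp
  have hs := one_lt_sub_one_div_sub_two hp
  have hC := (hCfun p hp).1
  have hcb : ContinuousAt (fun r => 1 / barenblattLam n r) p :=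
    continuousAt_const.div (continuousAt_barenblattLam n p) hΛ.ne'
  have hcR : ContinuousAt
      (fun r => (Cfun r / barenblattCoef n r) ^ (1 / (r / (r - 1)))) p :=
    (hcC.div hck hk.ne').rpow (continuousAt_const.div hcm (by linarith))
      (Or.inl (div_pos hC hk).ne')
  have hR0 : 0 < (Cfun p / barenblattCoef n p) ^ (1 / (p / (p - 1))) :=
    Real.rpow_pos_of_pos (div_pos hC hk) _
  have hR := hcR.eventually_le_const (lt_add_one _)
  have hev : ∀ᶠ r in nhds p, 2 < r := Ioi_mem_nhds hp
  have hn0 : (0 : ℝ) < n := by exact_mod_cast hn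
  refine ⟨fun q hq hqp => ?_, fun q hq hqp => ?_⟩
  · obtain ⟨M, hM⟩ : ∃ M, ∀ᶠ r in nhds p, Cfun r ^ ((r - 1) / (r - 2)) ≤ M :=
      ⟨_, (hcC.rpow hcs (Or.inl hC.ne')).eventually_le_const (lt_add_one _)⟩
    refine ((tendsto_selfSimilar volume (M := M) (N := n) (q := q) (p := p) (T := T)
      (b := fun r => 1 / barenblattLam n r)
      (φ := fun r => radialProfile (Cfun r) (barenblattCoef n r) (r / (r - 1))
        ((r - 1) / (r - 2))) U hT (add_pos hR0 one_pos).le n.cast_nonneg hq hcb (by positivity)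
        ?_ (fun r => measurable_radialProfile _ _ _ _) (hM.and hev |>.mono ?_)
        (hR.and hev |>.mono ?_) ?_).mono_left nhdsWithin_le_nhds).congr' ?_
    · rw [finrank_euclideanSpace_fin, ← sub_mul, mul_one_div, div_lt_one hΛ, barenblattLam]
      have := mul_lt_mul_of_pos_left hqp hn0
      have h2 : n * (p - 1 + p / n) = n * (p - 1) + p := by field_simp
      linarith
    · rintro r ⟨hMr, hr⟩ y
      exact (norm_radialProfile_le (hCfun r hr).1 (barenblattCoef_pos n hr).le
        (by linarith [one_lt_sub_one_div_sub_two hr]) y).trans hMr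
    · rintro r ⟨hRr, hr⟩ y hy
      exact radialProfile_eq_zero_of_lt_norm (hCfun r hr).1 (barenblattCoef_pos n hr)
        (one_lt_div_sub_one hr) (one_lt_sub_one_div_sub_two hr) (hRr.trans_lt hy)
    · exact fun c x hc => tendsto_radialProfile hcC hck hcm hcs (hc.smul_const x) hm hs
    · refine Eventually.of_forall fun r => setIntegral_congr_fun measurableSet_Ioo fun t ht => ?_
      simp only [barenblatt_eq _ _ ht.1, Real.norm_eq_abs]
  · obtain ⟨M, hM⟩ : ∃ M, ∀ᶠ r in nhds p,
        (r - 1) / (r - 2) * barenblattCoef n r * (r / (r - 1)) *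
          Cfun r ^ ((r - 1) / (r - 2) - 1) *
          ((Cfun r / barenblattCoef n r) ^ (1 / (r / (r - 1)))) ^ (r / (r - 1) - 1) ≤ M :=
      ⟨_, ((((hcs.mul hck).mul hcm).mul
        (hcC.rpow (hcs.sub continuousAt_const) (Or.inl hC.ne'))).mul
        (hcR.rpow (hcm.sub continuousAt_const) (Or.inl hR0.ne'))).eventually_le_const
          (lt_add_one _)⟩
    refine ((tendsto_selfSimilar volume (M := M) (N := n + 1) (q := q) (p := p) (T := T)
      (b := fun r => 1 / barenblattLam n r)
      (φ := fun r => radialProfileGrad (Cfun r) (barenblattCoef n r) (r / (r - 1))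
        ((r - 1) / (r - 2))) U hT (add_pos hR0 one_pos).le (by positivity) hq hcb (by positivity)
        ?_ (fun r => measurable_radialProfileGrad _ _ _ _) (hM.and hev |>.mono ?_)
        (hR.and hev |>.mono ?_) ?_).mono_left nhdsWithin_le_nhds).congr' ?_
    · rw [finrank_euclideanSpace_fin, ← sub_mul, mul_one_div, div_lt_one hΛ, barenblattLam]
      have := mul_lt_mul_of_pos_left hqp (show (0 : ℝ) < n + 1 by positivity)
      have h2 : ((n : ℝ) + 1) * (p - 1 + 1 / (n + 1)) = (n + 1) * (p - 1) + 1 := by field_simp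
      linarith
    · rintro r ⟨hMr, hr⟩ y
      exact (norm_radialProfileGrad_le (hCfun r hr).1 (barenblattCoef_pos n hr)
        (one_lt_div_sub_one hr) (one_lt_sub_one_div_sub_two hr) y).trans hMr
    · rintro r ⟨hRr, hr⟩ y hy
      exact radialProfileGrad_eq_zero_of_lt_norm (hCfun r hr).1 (barenblattCoef_pos n hr)
        (one_lt_div_sub_one hr) (one_lt_sub_one_div_sub_two hr) (hRr.trans_lt hy)
    · exact fun c x hc => tendsto_radialProfileGrad hcC hck hcm hcs (hc.smul_const x) hk hm hs
    · filter_upwards [self_mem_nhdsWithin] with r hr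
      refine setIntegral_congr_fun measurableSet_Ioo fun t ht => ?_
      simp only [gradient_barenblatt hr _ _ ht.1, gradient_barenblatt hp _ _ ht.1]
end
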